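/- Assume the Lr (a,τ) interval exchange transformation T is irreducible and satisfies the Keane Condition. If 𝓘(x) = 𝓘̃(y) for some x ∈ [0,1) and y ∈ (0,1], then x = y and this common point lies in R. -/

import Mathlib

open Set

noncomputable section

/-- `bpt a k = a_1 + ⋯ + a_k` (0-indexed: the sum of the first `k` entries of `a`);
these are the division points `b_k` of the interval exchange. -/
def bpt {n : ℕ} (a : Fin n → ℝ) (k : ℕ) : ℝ :=
  ∑ j ∈ Finset.univ.filter (fun j : Fin n => (j : ℕ) < k), a j

/-- The left-closed right-open interval `J_i = [b_{i-1}, b_i)` (0-indexed). -/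
def Jint {n : ℕ} (a : Fin n → ℝ) (i : Fin n) : Set ℝ :=
  Set.Ico (bpt a (i : ℕ)) (bpt a ((i : ℕ) + 1))

/-- The left-open right-closed interval `J̃_i = (b_{i-1}, b_i]` (0-indexed). -/
def Jtil {n : ℕ} (a : Fin n → ℝ) (i : Fin n) : Set ℝ :=
  Set.Ioc (bpt a (i : ℕ)) (bpt a ((i : ℕ) + 1))

/-- The permuted probability vector `a^τ`, with `a^τ_{τ(i)} = a_i`. -/
def aperm {n : ℕ} (a : Fin n → ℝ) (τ : Equiv.Perm (Fin n)) : Fin n → ℝ :=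
  fun j => a (τ.symm j)

/-- The set `D = {b_1, …, b_{n-1}}` of interior division points. -/
def Dset {n : ℕ} (a : Fin n → ℝ) : Set ℝ :=
  {x | ∃ k : ℕ, 0 < k ∧ k < n ∧ x = bpt a k}

/-- `a` is a positive probability vector. -/
def IsProbVec {n : ℕ} (a : Fin n → ℝ) : Prop :=
  (∀ i, 0 < a i) ∧ ∑ i, a i = 1

/-- `T` is the Lr `(a,τ)` interval exchange transformation: on each
`J_i = [b_{i-1}, b_i)` it is the translation `x ↦ x - b_{i-1} + b^τ_{τ(i)-1}`. -/
def IsLrIET {n : ℕ} (a : Fin n → ℝ) (τ : Equiv.Perm (Fin n)) (T : ℝ → ℝ) : Prop :=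
  ∀ i : Fin n, ∀ x ∈ Jint a i, T x = x - bpt a (i : ℕ) + bpt (aperm a τ) ((τ i : ℕ))

/-- `Tt` is the dual lR `(a,τ)` interval exchange transformation: on each
`J̃_i = (b_{i-1}, b_i]` it is the translation `x ↦ x - b_{i-1} + b^τ_{τ(i)-1}`. -/
def IslRIET {n : ℕ} (a : Fin n → ℝ) (τ : Equiv.Perm (Fin n)) (Tt : ℝ → ℝ) : Prop :=
  ∀ i : Fin n, ∀ x ∈ Jtil a i, Tt x = x - bpt a (i : ℕ) + bpt (aperm a τ) ((τ i : ℕ))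

/-- The Keane Condition: `D ∩ T^k(D) = ∅` for every positive integer `k`. -/
def KeaneCond {n : ℕ} (a : Fin n → ℝ) (T : ℝ → ℝ) : Prop :=
  ∀ k : ℕ, 0 < k → Dset a ∩ (T^[k] '' Dset a) = ∅

/-- `τ` is irreducible: `τ({1,…,j}) ≠ {1,…,j}` for `j = 1, …, n-1` (0-indexed:
no proper initial segment is invariant). -/
def IrreduciblePerm {n : ℕ} (τ : Equiv.Perm (Fin n)) : Prop :=
  ∀ j : ℕ, 0 < j → j < n →
    (fun i => τ i) '' {i : Fin n | (i : ℕ) < j} ≠ {i : Fin n | (i : ℕ) < j}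

/-- `P` is the family of ℤ-iterates of `T` on `[0,1)`: `P 0 = id`,
`P (k+1) = T ∘ P k`, and each `P k` maps `[0,1)` into itself. -/
def IsZIterLr (T : ℝ → ℝ) (P : ℤ → ℝ → ℝ) : Prop :=
  (∀ x ∈ Set.Ico (0 : ℝ) 1, P 0 x = x) ∧
  ∀ k : ℤ, ∀ x ∈ Set.Ico (0 : ℝ) 1, P k x ∈ Set.Ico (0 : ℝ) 1 ∧ P (k + 1) x = T (P k x)

/-- `Pt` is the family of ℤ-iterates of `Tt` on `(0,1]`. -/
def IsZIterlR (Tt : ℝ → ℝ) (Pt : ℤ → ℝ → ℝ) : Prop :=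
  (∀ x ∈ Set.Ioc (0 : ℝ) 1, Pt 0 x = x) ∧
  ∀ k : ℤ, ∀ x ∈ Set.Ioc (0 : ℝ) 1, Pt k x ∈ Set.Ioc (0 : ℝ) 1 ∧ Pt (k + 1) x = Tt (Pt k x)

/-- `I` is the itinerary map of `T` (with ℤ-iterates `P`):
`𝓘(x)_k = i ↔ T^k x ∈ J_i` for `x ∈ [0,1)`. -/
def IsItin {n : ℕ} (a : Fin n → ℝ) (P : ℤ → ℝ → ℝ) (I : ℝ → ℤ → Fin n) : Prop :=
  ∀ x ∈ Set.Ico (0 : ℝ) 1, ∀ k : ℤ, ∀ i : Fin n, (I x k = i ↔ P k x ∈ Jint a i)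

/-- `It` is the itinerary map of `Tt` (with ℤ-iterates `Pt`):
`𝓘̃(x)_k = i ↔ T̃^k x ∈ J̃_i` for `x ∈ (0,1]`. -/
def IsItinDual {n : ℕ} (a : Fin n → ℝ) (Pt : ℤ → ℝ → ℝ) (It : ℝ → ℤ → Fin n) : Prop :=
  ∀ x ∈ Set.Ioc (0 : ℝ) 1, ∀ k : ℤ, ∀ i : Fin n, (It x k = i ↔ Pt k x ∈ Jtil a i)

/-- `D_∞ = {0,1} ∪ ⋃_{k ∈ ℤ} T^k(D)`. -/
def Dinf {n : ℕ} (a : Fin n → ℝ) (P : ℤ → ℝ → ℝ) : Set ℝ :=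
  {0, 1} ∪ ⋃ k : ℤ, P k '' Dset a

/-- The set `R = [0,1] ∖ D_∞` of regular points. -/
def Rset {n : ℕ} (a : Fin n → ℝ) (P : ℤ → ℝ → ℝ) : Set ℝ :=
  Set.Icc 0 1 \ Dinf a P

/-- The shift `S` on `Ω = {1,…,n}^ℤ`: `S(α)_i = α_{i+1}`. -/
def shiftS {n : ℕ} (α : ℤ → Fin n) : ℤ → Fin n := fun i => α (i + 1)

/-- The `k`-th power of the shift: `(S^k α)_i = α_{i+k}`. -/
def shiftZ {n : ℕ} (k : ℤ) (α : ℤ → Fin n) : ℤ → Fin n := fun i => α (i + k)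

/-- `α, β` are positively asymptotic: `α_i = β_i` for all `i ≥ N`, some `N`. -/
def PosAsymp {n : ℕ} (α β : ℤ → Fin n) : Prop :=
  ∃ N : ℕ, ∀ i : ℤ, (N : ℤ) ≤ i → α i = β i

/-- `α, β` are negatively asymptotic: `α_i = β_i` for all `i ≤ -N`, some `N`. -/
def NegAsymp {n : ℕ} (α β : ℤ → Fin n) : Prop :=
  ∃ N : ℕ, ∀ i : ℤ, i ≤ -(N : ℤ) → α i = β i

section Breakpoints

variable {n : ℕ} {a : Fin n → ℝ}

lemma bpt_zero : bpt a 0 = 0 := by simp [bpt]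

lemma bpt_succ (i : Fin n) : bpt a ((i : ℕ) + 1) = bpt a (i : ℕ) + a i := by
  have h : Finset.univ.filter (fun j : Fin n => (j : ℕ) < (i : ℕ) + 1)
      = insert i (Finset.univ.filter (fun j : Fin n => (j : ℕ) < (i : ℕ))) := by
    ext j
    simp only [Finset.mem_filter, Finset.mem_univ, true_and, Finset.mem_insert, Fin.ext_iff]
    omega
  rw [bpt, h, Finset.sum_insert (by simp), bpt, add_comm]

lemma bpt_last (ha : IsProbVec a) : bpt a n = 1 := by
  simp [bpt, ha.2]

lemma bpt_mono (ha : IsProbVec a) : Monotone (bpt a) := by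
  intro k l hkl
  apply Finset.sum_le_sum_of_subset_of_nonneg
  · intro j hj
    simp only [Finset.mem_filter, Finset.mem_univ, true_and] at hj ⊢
    omega
  · intro i _ _
    exact (ha.1 i).le

lemma bpt_nonneg (ha : IsProbVec a) (k : ℕ) : 0 ≤ bpt a k := by
  simpa [bpt_zero] using bpt_mono ha (Nat.zero_le k)

lemma bpt_le_one (ha : IsProbVec a) {k : ℕ} (hk : k ≤ n) : bpt a k ≤ 1 := by
  simpa [bpt_last ha] using bpt_mono ha hk

lemma bpt_lt_one (ha : IsProbVec a) (i : Fin n) : bpt a (i : ℕ) < 1 := by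
  have h₁ := bpt_le_one ha (k := (i : ℕ) + 1) i.2
  have h₂ := bpt_succ (a := a) i
  have h₃ := ha.1 i
  linarith

lemma Dset_subset_Ico (ha : IsProbVec a) : Dset a ⊆ Ico 0 1 := by
  rintro _ ⟨k, -, hk, rfl⟩
  exact ⟨bpt_nonneg ha k, bpt_lt_one ha ⟨k, hk⟩⟩

lemma Jint_subset_Ico (ha : IsProbVec a) (i : Fin n) : Jint a i ⊆ Ico 0 1 := fun _ hx =>
  ⟨(bpt_nonneg ha _).trans hx.1, hx.2.trans_le (bpt_le_one ha i.2)⟩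

lemma eq_of_mem_Jint (ha : IsProbVec a) {i j : Fin n} {x : ℝ}
    (hi : x ∈ Jint a i) (hj : x ∈ Jint a j) : i = j := by
  obtain ⟨hi₁, hi₂⟩ := hi
  obtain ⟨hj₁, hj₂⟩ := hj
  rcases lt_trichotomy i j with h | h | h
  · have := bpt_mono ha (Nat.succ_le_of_lt (Fin.lt_def.1 h))
    simp only [Nat.succ_eq_add_one] at this
    linarith
  · exact h
  · have := bpt_mono ha (Nat.succ_le_of_lt (Fin.lt_def.1 h))
    simp only [Nat.succ_eq_add_one] at this
    linarith

/-- A division point is never interior to one of the exchanged intervals. -/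
lemma notMem_Dset_of_mem_Ioo (ha : IsProbVec a) {i : Fin n} {x : ℝ}
    (hx : x ∈ Ioo (bpt a (i : ℕ)) (bpt a ((i : ℕ) + 1))) : x ∉ Dset a := by
  rintro ⟨k, -, -, rfl⟩
  have h₁ : (i : ℕ) < k := (bpt_mono ha).reflect_lt hx.1
  have h₂ : k < (i : ℕ) + 1 := (bpt_mono ha).reflect_lt hx.2
  omega

lemma IsProbVec.aperm (ha : IsProbVec a) (τ : Equiv.Perm (Fin n)) :
    IsProbVec (aperm a τ) := by
  refine ⟨fun i => ha.1 _, ?_⟩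
  rw [← ha.2]
  exact Equiv.sum_comp τ.symm a

lemma IsLrIET.eq_of_apply_eq (ha : IsProbVec a) {τ : Equiv.Perm (Fin n)} {T : ℝ → ℝ}
    (hT : IsLrIET a τ T) {i j : Fin n} {x y : ℝ} (hx : x ∈ Jint a i) (hy : y ∈ Jint a j)
    (hxy : T x = T y) : x = y := by
  have key : ∀ (i : Fin n) (x : ℝ), x ∈ Jint a i → T x ∈ Jint (_root_.aperm a τ) (τ i) := by
    intro i x hx
    have h := bpt_succ (a := _root_.aperm a τ) (τ i)
    have h' := bpt_succ (a := a) i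
    have h'' : _root_.aperm a τ (τ i) = a i := by simp [_root_.aperm]
    rw [hT i x hx]
    obtain ⟨h₁, h₂⟩ := hx
    constructor <;> linarith
  have hij : i = j := by
    apply τ.injective
    apply eq_of_mem_Jint (ha.aperm τ) (key i x hx)
    rw [hxy]
    exact key j y hy
  subst hij
  rw [hT i x hx, hT i y hy] at hxy
  linarith

end Breakpoints

section Iterates

variable {n : ℕ} {a : Fin n → ℝ} {τ : Equiv.Perm (Fin n)} {T : ℝ → ℝ} {P : ℤ → ℝ → ℝ}

lemma IsZIterLr.add_natCast (hP : IsZIterLr T P) {x : ℝ} (hx : x ∈ Ico (0 : ℝ) 1) (m : ℤ)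
    (k : ℕ) : P k (P m x) = P (m + k) x := by
  have hm := (hP.2 m x hx).1
  induction k with
  | zero => simpa using hP.1 _ hm
  | succ k ih =>
    push_cast
    rw [(hP.2 k _ hm).2, ih, ← add_assoc, (hP.2 (m + k) x hx).2]

lemma IsZIterLr.iterate (hP : IsZIterLr T P) {x : ℝ} (hx : x ∈ Ico (0 : ℝ) 1) (k : ℕ) :
    P k x = T^[k] x := by
  induction k with
  | zero => simpa using hP.1 _ hx
  | succ k ih =>
    push_cast
    rw [(hP.2 k _ hx).2, ih, Function.iterate_succ_apply']

lemma IsZIterLr.injOn_natCast (hP : IsZIterLr T P) (hinj : InjOn T (Ico 0 1)) (k : ℕ) :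
    InjOn (P k) (Ico 0 1) := by
  intro x hx y hy h
  induction k with
  | zero =>
    rw [Nat.cast_zero, hP.1 x hx, hP.1 y hy] at h
    exact h
  | succ k ih =>
    push_cast at h
    rw [(hP.2 k x hx).2, (hP.2 k y hy).2] at h
    exact ih (hinj (hP.2 k x hx).1 (hP.2 k y hy).1 h)

lemma IsZIterLr.add (hP : IsZIterLr T P) (hinj : InjOn T (Ico 0 1)) {x : ℝ}
    (hx : x ∈ Ico (0 : ℝ) 1) (m k : ℤ) : P k (P m x) = P (m + k) x := by
  obtain ⟨j, rfl | rfl⟩ := k.eq_nat_or_neg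
  · exact hP.add_natCast hx m j
  · have hm := (hP.2 m x hx).1
    apply hP.injOn_natCast hinj j (hP.2 _ _ hm).1 (hP.2 _ _ hx).1
    rw [hP.add_natCast hm, hP.add_natCast hx]
    simpa using hP.1 _ hm

/-- The full orbit of the interior division points. -/
def divOrbit (a : Fin n → ℝ) (P : ℤ → ℝ → ℝ) : Set ℝ := ⋃ k : ℤ, P k '' Dset a

lemma mem_divOrbit {z : ℝ} : z ∈ divOrbit a P ↔ ∃ m : ℤ, ∃ d ∈ Dset a, P m d = z := by
  simp [divOrbit]

lemma Dset_subset_divOrbit (ha : IsProbVec a) (hP : IsZIterLr T P) :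
    Dset a ⊆ divOrbit a P := fun d hd =>
  mem_divOrbit.2 ⟨0, d, hd, hP.1 d (Dset_subset_Ico ha hd)⟩

lemma divOrbit_subset_Ico (ha : IsProbVec a) (hP : IsZIterLr T P) :
    divOrbit a P ⊆ Ico 0 1 := by
  intro z hz
  obtain ⟨m, d, hd, rfl⟩ := mem_divOrbit.1 hz
  exact (hP.2 m d (Dset_subset_Ico ha hd)).1

lemma apply_mem_divOrbit_iff (ha : IsProbVec a) (hP : IsZIterLr T P)
    (hinj : InjOn T (Ico 0 1)) {z : ℝ} (hz : z ∈ Ico (0 : ℝ) 1) (k : ℤ) :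
    P k z ∈ divOrbit a P ↔ z ∈ divOrbit a P := by
  constructor
  · intro h
    obtain ⟨m, d, hd, h⟩ := mem_divOrbit.1 h
    have hd' := Dset_subset_Ico ha hd
    refine mem_divOrbit.2 ⟨m + -k, d, hd, ?_⟩
    rw [← hP.add hinj hd', h, hP.add hinj hz, add_neg_cancel, hP.1 z hz]
  · intro h
    obtain ⟨m, d, hd, rfl⟩ := mem_divOrbit.1 h
    exact mem_divOrbit.2 ⟨m + k, d, hd, (hP.add hinj (Dset_subset_Ico ha hd) m k).symm⟩

/-- Under the Keane Condition no point in the orbit of a division point is periodic. -/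
lemma KeaneCond.apply_ne (hK : KeaneCond a T) (ha : IsProbVec a) (hP : IsZIterLr T P)
    (hinj : InjOn T (Ico 0 1)) {z : ℝ} (hz : z ∈ divOrbit a P) {k : ℕ} (hk : 0 < k) :
    P k z ≠ z := by
  intro h
  obtain ⟨m, d, hd, rfl⟩ := mem_divOrbit.1 hz
  have hd' := Dset_subset_Ico ha hd
  have h₁ : P k d = d := by
    have h₂ : P (-m) (P k (P m d)) = P (-m) (P m d) := by rw [h]
    rw [hP.add hinj hd', hP.add hinj hd', hP.add hinj hd'] at h₂
    simpa [hP.1 d hd'] using h₂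
  have h₃ : d ∈ Dset a ∩ (T^[k] '' Dset a) := ⟨hd, d, hd, by rw [← hP.iterate hd', h₁]⟩
  rw [hK k hk] at h₃
  exact h₃

lemma zero_mem_divOrbit (hn : 2 ≤ n) (ha : IsProbVec a) (hT : IsLrIET a τ T)
    (hP : IsZIterLr T P) (hirr : IrreduciblePerm τ) : (0 : ℝ) ∈ divOrbit a P := by
  let z : Fin n := ⟨0, by omega⟩
  have hz : τ (τ.symm z) = z := τ.apply_symm_apply z
  have hpos : 0 < (τ.symm z : ℕ) := by
    rw [Nat.pos_iff_ne_zero]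
    intro h0
    have h1 : τ.symm z = z := Fin.ext h0
    rw [h1] at hz
    apply hirr 1 one_pos (by omega)
    have : {i : Fin n | (i : ℕ) < 1} = {z} := by
      ext i
      simp [z, Fin.ext_iff]
    rw [this]
    simp [hz]
  have hd : bpt a (τ.symm z : ℕ) ∈ Dset a := ⟨_, hpos, (τ.symm z).2, rfl⟩
  have hJ : bpt a (τ.symm z : ℕ) ∈ Jint a (τ.symm z) := by
    refine ⟨le_rfl, ?_⟩
    rw [bpt_succ]
    linarith [ha.1 (τ.symm z)]
  refine mem_divOrbit.2 ⟨0 + 1, _, hd, ?_⟩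
  have hd' := Dset_subset_Ico ha hd
  rw [(hP.2 0 _ hd').2, hP.1 _ hd', hT _ _ hJ, hz]
  simp [z, bpt_zero]

lemma bpt_lt_of_notMem_divOrbit (ha : IsProbVec a) (hP : IsZIterLr T P)
    (h0 : (0 : ℝ) ∈ divOrbit a P) {i : Fin n} {z : ℝ} (hz : z ∈ Jint a i)
    (hz' : z ∉ divOrbit a P) : bpt a (i : ℕ) < z := by
  refine lt_of_le_of_ne hz.1 ?_
  rintro rfl
  apply hz'
  rcases Nat.eq_zero_or_pos (i : ℕ) with h | h
  · rwa [h, bpt_zero]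
  · exact Dset_subset_divOrbit ha hP ⟨i, h, i.2, rfl⟩

/-- Near a point outside the orbit of the division points, forward iterates are translations
on a left neighbourhood. -/
lemma exists_left_translation (ha : IsProbVec a) (hT : IsLrIET a τ T) (hP : IsZIterLr T P)
    (hinj : InjOn T (Ico 0 1)) (hJ : ∀ z ∈ Ico (0 : ℝ) 1, ∃ i, z ∈ Jint a i)
    (h0 : (0 : ℝ) ∈ divOrbit a P) {s : ℝ} (hs : s ∈ Ico (0 : ℝ) 1) (hs' : s ∉ divOrbit a P)
    (k : ℕ) : ∃ ε > 0, ∀ w, s - ε < w → w ≤ s → 0 ≤ w → P k w = w + (P k s - s) := by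
  induction k with
  | zero =>
    refine ⟨1, one_pos, fun w _ h₂ h₃ => ?_⟩
    rw [Nat.cast_zero, hP.1 w ⟨h₃, h₂.trans_lt hs.2⟩, hP.1 s hs]
    ring
  | succ k ih =>
    obtain ⟨ε, hε, h⟩ := ih
    obtain ⟨i, hi⟩ := hJ _ (hP.2 k s hs).1
    have hlt := bpt_lt_of_notMem_divOrbit ha hP h0 hi
      (fun hc => hs' ((apply_mem_divOrbit_iff ha hP hinj hs k).1 hc))
    refine ⟨min ε (P k s - bpt a i), lt_min hε (by linarith), fun w h₁ h₂ h₃ => ?_⟩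
    have h₄ := h w (by linarith [min_le_left ε (P k s - bpt a i)]) h₂ h₃
    have h₅ : P k w ∈ Jint a i := by
      obtain ⟨hi₁, hi₂⟩ := hi
      constructor <;> linarith [min_le_right ε (P k s - bpt a i)]
    push_cast
    rw [(hP.2 k w ⟨h₃, h₂.trans_lt hs.2⟩).2, (hP.2 k s hs).2, hT i _ h₅, hT i _ hi, h₄]
    ring

/-- Forward iterates are translations on any interval whose interior avoids the orbit of the
division points. -/
lemma exists_translation (ha : IsProbVec a) (hT : IsLrIET a τ T) (hP : IsZIterLr T P)
    (hinj : InjOn T (Ico 0 1)) (hJ : ∀ z ∈ Ico (0 : ℝ) 1, ∃ i, z ∈ Jint a i)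
    {s v : ℝ} (hs : 0 ≤ s) (hsv : s < v) (hv : v ≤ 1)
    (hfree : ∀ w ∈ Ioo s v, w ∉ divOrbit a P) (k : ℕ) :
    ∀ w ∈ Ico s v, P k w = w + (P k s - s) := by
  have hmem : ∀ w ∈ Ico s v, w ∈ Ico (0 : ℝ) 1 := fun w hw =>
    ⟨hs.trans hw.1, hw.2.trans_le hv⟩
  have hs' := hmem s ⟨le_rfl, hsv⟩
  induction k with
  | zero =>
    intro w hw
    rw [Nat.cast_zero, hP.1 w (hmem w hw), hP.1 s hs']
    ring
  | succ k ih =>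
    intro w hw
    obtain ⟨i, hi⟩ := hJ _ (hP.2 k s hs').1
    have hwk := ih w hw
    have hlt : P k w < bpt a ((i : ℕ) + 1) := by
      by_contra! hle
      have hin : (i : ℕ) + 1 < n := by
        refine lt_of_le_of_ne i.2 fun he => ?_
        rw [he, bpt_last ha] at hle
        exact hle.not_gt (hP.2 k w (hmem w hw)).1.2
      have hd : bpt a ((i : ℕ) + 1) ∈ Dset a := ⟨_, Nat.succ_pos _, hin, rfl⟩
      set t := bpt a ((i : ℕ) + 1) - (P k s - s) with ht
      have hi₂ := hi.2
      have ht' : t ∈ Ioo s v := ⟨by linarith, by linarith [hw.2]⟩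
      apply hfree t ht'
      rw [← apply_mem_divOrbit_iff ha hP hinj (hmem t ⟨ht'.1.le, ht'.2⟩) k,
        ih t ⟨ht'.1.le, ht'.2⟩]
      apply Dset_subset_divOrbit ha hP
      rwa [ht, sub_add_cancel]
    have hwJ : P k w ∈ Jint a i := ⟨by linarith [hi.1, hw.1], hlt⟩
    push_cast
    rw [(hP.2 k w (hmem w hw)).2, (hP.2 k s hs').2, hT i _ hwJ, hT i _ hi, hwk]
    ring

/-- Some positive iterate moves an interval, on which all iterates are translations, by less than
its length. -/
lemma exists_return (hP : IsZIterLr T P) (hinj : InjOn T (Ico 0 1))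
    {s v : ℝ} (hs : 0 ≤ s) (hsv : s < v) (hv : v ≤ 1)
    (htr : ∀ k : ℕ, ∀ w ∈ Ico s v, P k w = w + (P k s - s)) :
    ∃ k : ℕ, 0 < k ∧ |P k s - s| < v - s := by
  have hs' : s ∈ Ico (0 : ℝ) 1 := ⟨hs, hsv.trans_le hv⟩
  have hmem : ∀ w ∈ Ico s v, w ∈ Ico (0 : ℝ) 1 := fun w hw =>
    ⟨hs.trans hw.1, hw.2.trans_le hv⟩
  obtain ⟨i, j, hij, hclose⟩ : ∃ i j : ℕ, i < j ∧ |P j s - P i s| < v - s := by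
    have hc : IsCompact (Icc (0 : ℝ) 1) := isCompact_Icc
    obtain ⟨L, -, φ, hφ, hlim⟩ := hc.tendsto_subseq (x := fun k : ℕ => P k s)
      (fun k => Ico_subset_Icc_self (hP.2 k s hs').1)
    obtain ⟨N, hN⟩ := Metric.cauchySeq_iff'.1 hlim.cauchySeq (v - s) (by linarith)
    exact ⟨φ N, φ (N + 1), hφ (Nat.lt_succ_self N), hN (N + 1) (Nat.le_succ N)⟩
  obtain ⟨h₁, h₂⟩ := abs_lt.1 hclose
  have hadd : ∀ w ∈ Ico s v, P i (P (j - i : ℕ) w) = P j w := by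
    intro w hw
    rw [hP.add_natCast (hmem w hw), ← Nat.cast_add, Nat.sub_add_cancel hij.le]
  refine ⟨j - i, by omega, ?_⟩
  rcases le_total (P i s) (P j s) with h | h
  · have hw : s + (P j s - P i s) ∈ Ico s v := ⟨by linarith, by linarith⟩
    have : P (j - i : ℕ) s = s + (P j s - P i s) := by
      apply hP.injOn_natCast hinj i (hP.2 _ s hs').1 (hmem _ hw)
      rw [hadd s ⟨le_rfl, hsv⟩, htr i _ hw]
      ring
    rw [this, abs_lt]
    constructor <;> linarith
  · have hw : s + (P i s - P j s) ∈ Ico s v := ⟨by linarith, by linarith⟩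
    have : P (j - i : ℕ) (s + (P i s - P j s)) = s := by
      apply hP.injOn_natCast hinj i (hP.2 _ _ (hmem _ hw)).1 hs'
      rw [hadd _ hw, htr j _ hw]
      ring
    have h' := htr (j - i) _ hw
    rw [this] at h'
    rw [abs_lt]
    constructor <;> linarith

/-- Under the Keane Condition the orbit of the division points is dense in `[0,1]`. -/
lemma KeaneCond.exists_mem_Ioo (hK : KeaneCond a T) (ha : IsProbVec a) (hT : IsLrIET a τ T)
    (hP : IsZIterLr T P) (hinj : InjOn T (Ico 0 1))
    (hJ : ∀ z ∈ Ico (0 : ℝ) 1, ∃ i, z ∈ Jint a i) (h0 : (0 : ℝ) ∈ divOrbit a P)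
    {u v : ℝ} (hu : 0 ≤ u) (huv : u < v) (hv : v ≤ 1) : ∃ w ∈ Ioo u v, w ∈ divOrbit a P := by
  by_contra! hfree'
  set S := divOrbit a P ∩ Icc 0 u with hS
  have hbdd : BddAbove S := ⟨u, fun z hz => hz.2.2⟩
  have h0S : (0 : ℝ) ∈ S := ⟨h0, le_rfl, hu⟩
  set s := sSup S with hs_def
  have hs : 0 ≤ s := le_csSup hbdd h0S
  have hsu : s ≤ u := csSup_le ⟨0, h0S⟩ fun z hz => hz.2.2
  have hsv : s < v := hsu.trans_lt huv
  have hs' : s ∈ Ico (0 : ℝ) 1 := ⟨hs, hsv.trans_le hv⟩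
  have happrox : ∀ ε > 0, ∃ w ∈ divOrbit a P, s - ε < w ∧ w ≤ s := by
    intro ε hε
    obtain ⟨w, hw, hlt⟩ := exists_lt_of_lt_csSup ⟨0, h0S⟩ (sub_lt_self s hε)
    exact ⟨w, hw.1, hlt, le_csSup hbdd hw⟩
  have hmem : ∀ w ∈ Ico s v, w ∈ Ico (0 : ℝ) 1 := fun w hw =>
    ⟨hs.trans hw.1, hw.2.trans_le hv⟩
  have hpos := divOrbit_subset_Ico ha hP
  have hfree : ∀ w ∈ Ioo s v, w ∉ divOrbit a P := by
    intro w hw hwB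
    rcases le_or_gt w u with h | h
    · exact (le_csSup hbdd ⟨hwB, (hpos hwB).1, h⟩).not_gt hw.1
    · exact hfree' w ⟨h, hw.2⟩ hwB
  have htr := exists_translation ha hT hP hinj hJ hs hsv hv hfree
  obtain ⟨k, hk, hclose⟩ := exists_return hP hinj hs hsv hv htr
  obtain ⟨hc₁, hc₂⟩ := abs_lt.1 hclose
  rcases lt_or_ge (P k s - s) 0 with hc | hc
  · obtain ⟨w, hw, hw₁, hw₂⟩ := happrox (-(P k s - s)) (by linarith)
    have ht : w - (P k s - s) ∈ Ioo s v := ⟨by linarith, by linarith⟩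
    apply hfree _ ht
    rw [← apply_mem_divOrbit_iff ha hP hinj (hmem _ ⟨ht.1.le, ht.2⟩) k,
      htr k _ ⟨ht.1.le, ht.2⟩, sub_add_cancel]
    exact hw
  · have hex : ∀ ε > 0, ∃ w ∈ divOrbit a P, s - ε < w ∧ w ≤ s ∧ P k w = w + (P k s - s) := by
      intro ε hε
      by_cases hsB : s ∈ divOrbit a P
      · exact ⟨s, hsB, by linarith, le_rfl, by ring⟩
      · obtain ⟨η, hη, h⟩ := exists_left_translation ha hT hP hinj hJ h0 hs' hsB k
        obtain ⟨w, hw, hw₁, hw₂⟩ := happrox (min ε η) (lt_min hε hη)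
        exact ⟨w, hw, by linarith [min_le_left ε η], hw₂,
          h w (by linarith [min_le_right ε η]) hw₂ (hpos hw).1⟩
    rcases hc.eq_or_lt with hc | hc
    · obtain ⟨w, hw, -, -, h⟩ := hex 1 one_pos
      rw [← hc, add_zero] at h
      exact hK.apply_ne ha hP hinj hw hk h
    · obtain ⟨w, hw, hw₁, hw₂, h⟩ := hex _ hc
      apply hfree (P k w) ⟨by linarith, by linarith⟩
      exact (apply_mem_divOrbit_iff ha hP hinj (hpos hw) k).2 hw

end Iterates

/-- Theorem 4.5 (iii): under irreducibility and the Keane Condition,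
if `𝓘(x) = 𝓘̃(y)` for some `x ∈ [0,1)`, `y ∈ (0,1]`, then `x = y` and the common
point lies in `R`. -/
theorem stmt17 {n : ℕ} (hn : 2 ≤ n) (a : Fin n → ℝ) (ha : IsProbVec a)
    (τ : Equiv.Perm (Fin n)) (T Tt : ℝ → ℝ)
    (hT : IsLrIET a τ T) (hTt : IslRIET a τ Tt)
    (P Pt : ℤ → ℝ → ℝ) (hP : IsZIterLr T P) (hPt : IsZIterlR Tt Pt)
    (I It : ℝ → ℤ → Fin n) (hI : IsItin a P I) (hIt : IsItinDual a Pt It)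
    (hirr : IrreduciblePerm τ) (hKeane : KeaneCond a T)
    (x : ℝ) (hx : x ∈ Set.Ico (0 : ℝ) 1) (y : ℝ) (hy : y ∈ Set.Ioc (0 : ℝ) 1)
    (hxy : I x = It y) :
    x = y ∧ x ∈ Rset a P := by
  have hcode : ∀ k, P k x ∈ Jint a (I x k) ∧ Pt k y ∈ Jtil a (I x k) := fun k =>
    ⟨(hI x hx k _).1 rfl, (hIt y hy k _).1 (congrFun hxy k).symm⟩
  have hJ : ∀ z ∈ Ico (0 : ℝ) 1, ∃ i, z ∈ Jint a i := fun z hz =>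
    ⟨I z 0, by simpa [hP.1 z hz] using (hI z hz 0 _).1 rfl⟩
  have hinj : InjOn T (Ico 0 1) := by
    intro z hz w hw h
    obtain ⟨i, hi⟩ := hJ z hz
    obtain ⟨j, hj⟩ := hJ w hw
    exact hT.eq_of_apply_eq ha hi hj h
  have h0 := zero_mem_divOrbit hn ha hT hP hirr
  have hstep : ∀ k, P (k + 1) x - Pt (k + 1) y = P k x - Pt k y := by
    intro k
    rw [(hP.2 k x hx).2, (hPt.2 k y hy).2, hT _ _ (hcode k).1, hTt _ _ (hcode k).2]
    ring
  have hdiff : ∀ k, P k x - Pt k y = x - y := by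
    intro k
    induction k using Int.induction_on with
    | zero => rw [hP.1 x hx, hPt.1 y hy]
    | succ k ih => rw [hstep, ih]
    | pred k ih => rw [← ih, ← hstep (-(k : ℤ) - 1), sub_add_cancel]
  have heq : x = y := by
    by_contra hne
    have hbetween : ∀ k, ∀ w ∈ Ioo (min x y) (max x y), w + (P k x - x) ∈
        Ioo (bpt a (I x k : ℕ)) (bpt a ((I x k : ℕ) + 1)) := by
      intro k w hw
      obtain ⟨⟨h₁, h₂⟩, h₃, h₄⟩ := hcode k
      have h₅ := hdiff k
      obtain ⟨hw₁, hw₂⟩ := hw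
      rcases le_total x y with h | h
      · rw [min_eq_left h] at hw₁
        rw [max_eq_right h] at hw₂
        constructor <;> linarith
      · rw [min_eq_right h] at hw₁
        rw [max_eq_left h] at hw₂
        constructor <;> linarith
    obtain ⟨w, hw, hwB⟩ := hKeane.exists_mem_Ioo ha hT hP hinj hJ h0 (u := min x y)
      (v := max x y) (le_min hx.1 hy.1.le) (min_lt_max.2 hne) (max_le hx.2.le hy.2)
    have hw' := divOrbit_subset_Ico ha hP hwB
    have hJw : ∀ k, w + (P k x - x) ∈ Jint a (I x k) := fun k =>
      Ioo_subset_Ico_self (hbetween k w hw)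
    have hTw : ∀ k, T (w + (P k x - x)) = w + (P (k + 1) x - x) := by
      intro k
      rw [(hP.2 k x hx).2, hT _ _ (hJw k), hT _ _ (hcode k).1]
      ring
    have htr : ∀ k, P k w = w + (P k x - x) := by
      intro k
      induction k using Int.induction_on with
      | zero => rw [hP.1 x hx, hP.1 w hw']; ring
      | succ k ih => rw [(hP.2 k w hw').2, ih, hTw]
      | pred k ih =>
        apply hinj (hP.2 _ w hw').1 (Jint_subset_Ico ha _ (hJw _))
        rw [hTw, ← (hP.2 _ w hw').2, sub_add_cancel, ih]
    obtain ⟨m, d, hd, rfl⟩ := mem_divOrbit.1 hwB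
    apply notMem_Dset_of_mem_Ioo ha (hbetween (-m) _ hw)
    have hd' := Dset_subset_Ico ha hd
    rwa [← htr, hP.add hinj hd', add_neg_cancel, hP.1 d hd']
  subst heq
  refine ⟨rfl, ⟨hx.1, hx.2.le⟩, ?_⟩
  rintro ((h | h) | h)
  · exact hy.1.ne' h
  · exact hx.2.ne h
  · obtain ⟨m, d, hd, rfl⟩ := mem_divOrbit.1 h
    have hd' := Dset_subset_Ico ha hd
    have h₁ := hcode (-m)
    have h₂ := hdiff (-m)
    rw [sub_self, sub_eq_zero] at h₂
    rw [← h₂] at h₁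
    have h₃ := notMem_Dset_of_mem_Ioo ha (i := I (P m d) (-m)) ⟨h₁.2.1, h₁.1.2⟩
    rw [hP.add hinj hd', add_neg_cancel, hP.1 d hd'] at h₃
    exact h₃ hd
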